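/- Bernstein-type corollary of the concentration theorem: Let n ≥ 1, d ≥ 1, let σ be a uniformly random permutation of [n], and let φ be a multilinear polynomial of degree at most d with non-negative coefficients. Set A_φ := M(φ)·N(φ) and A_{∇φ} := max_{i,j∈[n]} M(∂_{ij}φ)·N(∂_{ij}φ), and define α_φ := 6·d·2^d·A_{∇φ}·( max(0, log(4·A_φ·n/A_{∇φ})) + (2/n)(2 − e^{−2/n})/(1 − e^{−2/n}) ). Then for all t ≥ 0: P[ |φ(σ) − E[φ]| ≥ t ] ≤ 2·exp( −t² / ( 2·α_φ·( (4/3)·E[φ] + (2^{d+1}(d−1)/(3n))·A_φ + t ) ) ). -/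

import Mathlib

open MvPolynomial

noncomputable section

/-- The permutation matrix of `σ`, as an assignment of values to the indeterminates `X_{ij}`. -/
def permMat (n : ℕ) (σ : Equiv.Perm (Fin n)) : Fin n × Fin n → ℝ :=
  fun p => if σ p.1 = p.2 then 1 else 0

/-- Evaluation of a polynomial in the indeterminates `X_{ij}` at the permutation matrix of `σ`. -/
def permEval (n : ℕ) (φ : MvPolynomial (Fin n × Fin n) ℝ) (σ : Equiv.Perm (Fin n)) : ℝ :=
  eval (permMat n σ) φ

/-- Multilinearity: `∂_{ij}∂_{ik} φ ≡ 0` and `∂_{ji}∂_{ki} φ ≡ 0` for all `i, j, k`. -/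
def IsMultilinear (n : ℕ) (φ : MvPolynomial (Fin n × Fin n) ℝ) : Prop :=
  ∀ i j k : Fin n,
    pderiv (i, j) (pderiv (i, k) φ) = 0 ∧ pderiv (j, i) (pderiv (k, i) φ) = 0

/-- Mean of `φ(σ)` over a uniformly random permutation `σ`. -/
def permExp (n : ℕ) (φ : MvPolynomial (Fin n × Fin n) ℝ) : ℝ :=
  (∑ σ : Equiv.Perm (Fin n), permEval n φ σ) / (Fintype.card (Equiv.Perm (Fin n)) : ℝ)

/-- Probability of an event under the uniform measure on the symmetric group. -/
def permProb (n : ℕ) (p : Equiv.Perm (Fin n) → Prop) : ℝ :=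
  (Set.ncard {σ : Equiv.Perm (Fin n) | p σ} : ℝ) / (Fintype.card (Equiv.Perm (Fin n)) : ℝ)

/-- `M(φ)`: the maximal absolute value of a coefficient of `φ`. -/
def maxCoeff (n : ℕ) (φ : MvPolynomial (Fin n × Fin n) ℝ) : ℝ :=
  ⨆ m ∈ φ.support, |φ.coeff m|

open scoped Classical in
/-- `N(φ,σ)`: the number of monomials of `φ` evaluating to a nonzero value at `σ`. -/
def numNonzero (n : ℕ) (φ : MvPolynomial (Fin n × Fin n) ℝ) (σ : Equiv.Perm (Fin n)) : ℕ :=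
  (φ.support.filter fun m => eval (permMat n σ) (monomial m (φ.coeff m)) ≠ 0).card

/-- `N(φ) = max_σ N(φ,σ)`. -/
def maxNumNonzero (n : ℕ) (φ : MvPolynomial (Fin n × Fin n) ℝ) : ℕ :=
  Finset.univ.sup fun σ : Equiv.Perm (Fin n) => numNonzero n φ σ

/-- `A_φ := M(φ)·N(φ)`. -/
def Aconst (n : ℕ) (φ : MvPolynomial (Fin n × Fin n) ℝ) : ℝ :=
  maxCoeff n φ * (maxNumNonzero n φ : ℝ)

/-- `A_{∇φ} := max_{i,j} A_{∂_{ij} φ}`. -/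
def AgradConst (n : ℕ) (φ : MvPolynomial (Fin n × Fin n) ℝ) : ℝ :=
  ⨆ q : Fin n × Fin n, Aconst n (pderiv q φ)

/-- The constant `α_φ`. -/
def alphaConst (n d : ℕ) (φ : MvPolynomial (Fin n × Fin n) ℝ) : ℝ :=
  6 * (d : ℝ) * 2 ^ d * AgradConst n φ *
    (max 0 (Real.log (4 * Aconst n φ * (n : ℝ) / AgradConst n φ)) +
      (2 / (n : ℝ)) * (2 - Real.exp (-2 / (n : ℝ))) / (1 - Real.exp (-2 / (n : ℝ))))

section Forcing

/-- Forcing `σ i = j` by a transposition turns the uniform distribution on permutations extending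
`s` into a multiple of the uniform distribution on those extending `insert (i, j) s`. -/
lemma card_mul_sum_insert {n : ℕ} (s : Finset (Fin n × Fin n)) (i j : Fin n)
    (hi : ∀ p ∈ s, p.1 ≠ i) (hj : ∀ p ∈ s, p.2 ≠ j) (g : Equiv.Perm (Fin n) → ℝ) :
    ((Finset.univ \ s.image Prod.snd).card : ℝ) *
        ∑ σ with ∀ p ∈ insert (i, j) s, σ p.1 = p.2, g σ =
      ∑ σ : Equiv.Perm (Fin n) with ∀ p ∈ s, σ p.1 = p.2, g (Equiv.swap (σ i) j * σ) := by
  have hmaps : ∀ σ ∈ Finset.univ.filter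
      (fun σ : Equiv.Perm (Fin n) => ∀ p ∈ s, σ p.1 = p.2),
      σ i ∈ Finset.univ \ s.image Prod.snd := by
    intro σ hσ
    simp only [Finset.mem_filter, Finset.mem_univ, true_and] at hσ
    simp only [Finset.mem_sdiff, Finset.mem_univ, true_and, Finset.mem_image, not_exists, not_and]
    intro p hp h
    rw [← hσ p hp] at h
    exact hi p hp (σ.injective h)
  rw [← Finset.sum_fiberwise_of_maps_to hmaps, ← nsmul_eq_mul, ← Finset.sum_const]
  refine Finset.sum_congr rfl fun a ha => ?_
  have ha' : ∀ p ∈ s, p.2 ≠ a := by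
    intro p hp h
    simp only [Finset.mem_sdiff, Finset.mem_univ, true_and, Finset.mem_image, not_exists,
      not_and] at ha
    exact ha p hp h
  refine Finset.sum_bij' (fun σ _ => Equiv.swap a j * σ) (fun σ _ => Equiv.swap a j * σ)
    ?_ ?_ ?_ ?_ ?_
  · intro σ hσ
    simp only [Finset.mem_filter, Finset.mem_univ, true_and, Finset.mem_insert,
      forall_eq_or_imp] at hσ ⊢
    refine ⟨fun p hp => ?_, ?_⟩
    · rw [Equiv.Perm.mul_apply, hσ.2 p hp, Equiv.swap_apply_of_ne_of_ne (ha' p hp) (hj p hp)]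
    · rw [Equiv.Perm.mul_apply, hσ.1, Equiv.swap_apply_right]
  · intro σ hσ
    simp only [Finset.mem_filter, Finset.mem_univ, true_and, Finset.mem_insert,
      forall_eq_or_imp] at hσ ⊢
    refine ⟨?_, fun p hp => ?_⟩
    · rw [Equiv.Perm.mul_apply, hσ.2, Equiv.swap_apply_left]
    · rw [Equiv.Perm.mul_apply, hσ.1 p hp, Equiv.swap_apply_of_ne_of_ne (ha' p hp) (hj p hp)]
  · intro σ _
    simp [← mul_assoc]
  · intro σ _
    simp [← mul_assoc]
  · intro σ hσ
    simp only [Finset.mem_filter, Finset.mem_univ, true_and, Finset.mem_insert,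
      forall_eq_or_imp] at hσ
    rw [Equiv.Perm.mul_apply, hσ.1, Equiv.swap_apply_right, ← mul_assoc, Equiv.swap_mul_self,
      one_mul]

/-- If forcing one value changes `g` by a factor at most `K`, then the mean of `g` over the
permutations extending `s` is at most `K ^ #s` times its mean over all permutations. -/
lemma sum_extending_le {n : ℕ} (g : Equiv.Perm (Fin n) → ℝ) (K : ℝ) (hK : 0 ≤ K)
    (hg : ∀ σ i j, g (Equiv.swap (σ i) j * σ) ≤ K * g σ) (s : Finset (Fin n × Fin n)) :
    (∑ σ with ∀ p ∈ s, σ p.1 = p.2, g σ) * (Fintype.card (Equiv.Perm (Fin n)) : ℝ) ≤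
      K ^ s.card * (∑ σ : Equiv.Perm (Fin n) with ∀ p ∈ s, σ p.1 = p.2, (1 : ℝ)) * ∑ σ, g σ := by
  induction s using Finset.induction_on with
  | empty => simp [mul_comm]
  | insert p s hp ih =>
    obtain ⟨i, j⟩ := p
    by_cases hcomp : (∀ p ∈ s, p.1 ≠ i) ∧ ∀ p ∈ s, p.2 ≠ j
    · obtain ⟨hi, hj⟩ := hcomp
      have hC : (0 : ℝ) < ((Finset.univ \ s.image Prod.snd).card : ℝ) := by
        rw [Nat.cast_pos, Finset.card_pos]
        refine ⟨j, ?_⟩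
        simp only [Finset.mem_sdiff, Finset.mem_univ, true_and, Finset.mem_image, not_exists,
          not_and]
        exact hj
      have h1 := card_mul_sum_insert s i j hi hj (fun _ => 1)
      have h2 := card_mul_sum_insert s i j hi hj g
      have h3 : ∑ σ : Equiv.Perm (Fin n) with ∀ p ∈ s, σ p.1 = p.2, g (Equiv.swap (σ i) j * σ) ≤
          K * ∑ σ with ∀ p ∈ s, σ p.1 = p.2, g σ := by
        rw [Finset.mul_sum]
        exact Finset.sum_le_sum fun σ _ => hg σ i j
      rw [← h2] at h3
      rw [← h1] at ih
      rw [Finset.card_insert_of_notMem hp]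
      refine le_of_mul_le_mul_left ?_ hC
      calc _ = (((Finset.univ \ s.image Prod.snd).card : ℝ) *
              ∑ σ with ∀ p ∈ insert (i, j) s, σ p.1 = p.2, g σ) *
              (Fintype.card (Equiv.Perm (Fin n)) : ℝ) := by ring
        _ ≤ _ := mul_le_mul_of_nonneg_right h3 (Nat.cast_nonneg _)
        _ = K * (_ * _) := mul_assoc _ _ _
        _ ≤ _ := mul_le_mul_of_nonneg_left ih hK
        _ = _ := by ring
    · have hempty : Finset.univ.filter
          (fun σ : Equiv.Perm (Fin n) => ∀ p ∈ insert (i, j) s, σ p.1 = p.2) = ∅ := by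
        rw [Finset.filter_eq_empty_iff]
        intro σ _ hσ
        simp only [Finset.mem_insert, forall_eq_or_imp] at hσ
        apply hcomp
        constructor
        · rintro ⟨a, b⟩ hq rfl
          apply hp
          have := hσ.2 _ hq
          simp only at this hσ
          rw [← hσ.1, this]
          exact hq
        · rintro ⟨a, b⟩ hq rfl
          apply hp
          have := hσ.2 _ hq
          simp only at this hσ
          rw [σ.injective (hσ.1.trans this.symm)]
          exact hq
      rw [hempty]
      simp

end Forcing

section Evaluation

lemma prod_permMat_pow (n : ℕ) (σ : Equiv.Perm (Fin n)) (m : Fin n × Fin n →₀ ℕ) :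
    (m.prod fun p k => permMat n σ p ^ k) = if ∀ p ∈ m.support, σ p.1 = p.2 then 1 else 0 := by
  split_ifs with h
  · refine Finset.prod_eq_one fun p hp => ?_
    simp [permMat, h p hp]
  · push Not at h
    obtain ⟨p, hp, hne⟩ := h
    refine Finset.prod_eq_zero hp ?_
    simp [permMat, hne, Finsupp.mem_support_iff.mp hp]

lemma permEval_eq_sum (n : ℕ) (φ : MvPolynomial (Fin n × Fin n) ℝ) (σ : Equiv.Perm (Fin n)) :
    permEval n φ σ =
      ∑ m ∈ φ.support, φ.coeff m * if ∀ p ∈ m.support, σ p.1 = p.2 then 1 else 0 := by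
  rw [permEval, eval_eq]
  refine Finset.sum_congr rfl fun m _ => ?_
  rw [← prod_permMat_pow]
  rfl

lemma permEval_nonneg (n : ℕ) (φ : MvPolynomial (Fin n × Fin n) ℝ) (hpos : ∀ m, 0 ≤ φ.coeff m)
    (σ : Equiv.Perm (Fin n)) : 0 ≤ permEval n φ σ := by
  rw [permEval_eq_sum]
  refine Finset.sum_nonneg fun m _ => mul_nonneg (hpos m) ?_
  split_ifs <;> norm_num

lemma abs_coeff_le_maxCoeff (n : ℕ) (φ : MvPolynomial (Fin n × Fin n) ℝ)
    {m : Fin n × Fin n →₀ ℕ} (hm : m ∈ φ.support) : |φ.coeff m| ≤ maxCoeff n φ := by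
  have hbdd : BddAbove (Set.range fun m => ⨆ (_ : m ∈ φ.support), |φ.coeff m|) := by
    refine ⟨∑ m ∈ φ.support, |φ.coeff m|, ?_⟩
    rintro _ ⟨k, rfl⟩
    refine Real.iSup_le (fun hk => ?_) (Finset.sum_nonneg fun _ _ => abs_nonneg _)
    exact Finset.single_le_sum (f := fun m => |φ.coeff m|) (fun _ _ => abs_nonneg _) hk
  refine le_trans ?_ (le_ciSup hbdd m)
  simp [mem_support_iff.mp hm]

lemma maxCoeff_nonneg (n : ℕ) (φ : MvPolynomial (Fin n × Fin n) ℝ) : 0 ≤ maxCoeff n φ :=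
  Real.iSup_nonneg fun _ => Real.iSup_nonneg fun _ => abs_nonneg _

lemma Aconst_nonneg (n : ℕ) (φ : MvPolynomial (Fin n × Fin n) ℝ) : 0 ≤ Aconst n φ :=
  mul_nonneg (maxCoeff_nonneg n φ) (Nat.cast_nonneg _)

lemma Aconst_pderiv_le (n : ℕ) (φ : MvPolynomial (Fin n × Fin n) ℝ) (q : Fin n × Fin n) :
    Aconst n (pderiv q φ) ≤ AgradConst n φ :=
  le_ciSup (f := fun q => Aconst n (pderiv q φ)) (Set.finite_range _).bddAbove q

lemma AgradConst_nonneg (n : ℕ) (φ : MvPolynomial (Fin n × Fin n) ℝ) : 0 ≤ AgradConst n φ :=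
  Real.iSup_nonneg fun _ => Aconst_nonneg _ _

open scoped Classical in
lemma permEval_le_Aconst (n : ℕ) (φ : MvPolynomial (Fin n × Fin n) ℝ) (σ : Equiv.Perm (Fin n)) :
    permEval n φ σ ≤ Aconst n φ := by
  have h1 : permEval n φ σ = ∑ m ∈ φ.support with
      eval (permMat n σ) (monomial m (φ.coeff m)) ≠ 0,
      eval (permMat n σ) (monomial m (φ.coeff m)) := by
    rw [Finset.sum_filter_ne_zero, ← map_sum, ← φ.as_sum, permEval]
  have h2 : ∀ m ∈ φ.support.filter (fun m => eval (permMat n σ) (monomial m (φ.coeff m)) ≠ 0),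
      eval (permMat n σ) (monomial m (φ.coeff m)) ≤ maxCoeff n φ := by
    intro m hm
    rw [eval_monomial, prod_permMat_pow]
    refine le_trans ?_ (abs_coeff_le_maxCoeff n φ (Finset.mem_filter.mp hm).1)
    split_ifs
    · simpa using le_abs_self _
    · simp
  rw [h1]
  refine (Finset.sum_le_card_nsmul _ _ _ h2).trans ?_
  rw [nsmul_eq_mul, mul_comm, Aconst]
  refine mul_le_mul_of_nonneg_left ?_ (maxCoeff_nonneg n φ)
  exact_mod_cast Finset.le_sup (f := fun σ => numNonzero n φ σ) (Finset.mem_univ σ)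

lemma permEval_pderiv (n : ℕ) (φ : MvPolynomial (Fin n × Fin n) ℝ) (q : Fin n × Fin n)
    (σ : Equiv.Perm (Fin n)) :
    permEval n (pderiv q φ) σ = ∑ m ∈ φ.support, φ.coeff m * (m q : ℝ) *
      if ∀ p ∈ (m - Finsupp.single q 1).support, σ p.1 = p.2 then 1 else 0 := by
  conv_lhs => rw [permEval, φ.as_sum, map_sum, map_sum]
  refine Finset.sum_congr rfl fun m _ => ?_
  rw [pderiv_monomial, eval_monomial, prod_permMat_pow]

/-- Forcing one value of `σ` creates at most two new entries of the permutation matrix, hence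
increases `φ` by at most `2 * A_{∇φ}`. -/
lemma permEval_swap_mul_le (n : ℕ) (φ : MvPolynomial (Fin n × Fin n) ℝ)
    (hpos : ∀ m, 0 ≤ φ.coeff m) (σ : Equiv.Perm (Fin n)) (i j : Fin n) :
    permEval n φ (Equiv.swap (σ i) j * σ) ≤ permEval n φ σ + 2 * AgradConst n φ := by
  set τ := Equiv.swap (σ i) j * σ with hτ
  have hq : ∀ q, permEval n (pderiv q φ) τ ≤ AgradConst n φ := fun q =>
    (permEval_le_Aconst n _ τ).trans (Aconst_pderiv_le n φ q)
  have key : permEval n φ τ ≤ permEval n φ σ + permEval n (pderiv (i, j) φ) τ +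
      permEval n (pderiv (σ.symm j, σ i) φ) τ := by
    rw [permEval_eq_sum, permEval_eq_sum, permEval_pderiv, permEval_pderiv,
      ← Finset.sum_add_distrib, ← Finset.sum_add_distrib]
    refine Finset.sum_le_sum fun m _ => ?_
    simp only [mul_assoc]
    rw [← mul_add, ← mul_add]
    refine mul_le_mul_of_nonneg_left ?_ (hpos m)
    have hnonneg : ∀ q, (0 : ℝ) ≤ (m q : ℝ) *
        if ∀ p ∈ (m - Finsupp.single q 1).support, τ p.1 = p.2 then 1 else 0 := by
      intro q
      split_ifs <;> simp
    have hnonneg' : (0 : ℝ) ≤ if ∀ p ∈ m.support, σ p.1 = p.2 then 1 else 0 := by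
      split_ifs <;> norm_num
    have hA := hnonneg (i, j)
    have hB := hnonneg (σ.symm j, σ i)
    by_cases hm : ∀ p ∈ m.support, τ p.1 = p.2
    · have hone : ∀ q ∈ m.support, (1 : ℝ) ≤ (m q : ℝ) *
          if ∀ p ∈ (m - Finsupp.single q 1).support, τ p.1 = p.2 then 1 else 0 := by
        intro q hqm
        rw [if_pos, mul_one]
        · exact_mod_cast Nat.one_le_iff_ne_zero.mpr (Finsupp.mem_support_iff.mp hqm)
        · intro p hp
          refine hm p (Finsupp.mem_support_iff.mpr fun h0 => ?_)
          simp [h0] at hp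
      rw [if_pos hm]
      by_cases h1 : (i, j) ∈ m.support
      · linarith [hone _ h1]
      by_cases h2 : (σ.symm j, σ i) ∈ m.support
      · linarith [hone _ h2]
      have h3 : ∀ p ∈ m.support, σ p.1 = p.2 := by
        rintro ⟨a, b⟩ hp
        have hab := hm _ hp
        simp only [hτ, Equiv.Perm.mul_apply] at hab ⊢
        by_cases ha : σ a = σ i
        · rw [ha, Equiv.swap_apply_left] at hab
          rw [σ.injective ha, ← hab] at hp
          exact absurd hp h1
        by_cases hb : σ a = j
        · rw [hb, Equiv.swap_apply_right] at hab
          rw [← hab, ← σ.symm_apply_apply a, hb] at hp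
          exact absurd hp h2
        rwa [Equiv.swap_apply_of_ne_of_ne ha hb] at hab
      rw [if_pos h3]
      linarith
    · rw [if_neg hm]
      linarith
  linarith [hq (i, j), hq (σ.symm j, σ i)]

lemma card_support_le_of_totalDegree_le {ι : Type*} {d : ℕ} {φ : MvPolynomial ι ℝ}
    (hdeg : φ.totalDegree ≤ d) {m : ι →₀ ℕ} (hm : m ∈ φ.support) : m.support.card ≤ d := by
  refine le_trans ?_ ((le_totalDegree hm).trans hdeg)
  rw [Finset.card_eq_sum_ones]
  exact Finset.sum_le_sum fun p hp =>
    Nat.one_le_iff_ne_zero.mpr (Finsupp.mem_support_iff.mp hp)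

lemma sum_permEval_mul (n : ℕ) (φ : MvPolynomial (Fin n × Fin n) ℝ)
    (g : Equiv.Perm (Fin n) → ℝ) :
    ∑ σ, permEval n φ σ * g σ =
      ∑ m ∈ φ.support, φ.coeff m * ∑ σ with ∀ p ∈ m.support, σ p.1 = p.2, g σ := by
  simp only [permEval_eq_sum, Finset.sum_mul]
  rw [Finset.sum_comm]
  refine Finset.sum_congr rfl fun m _ => ?_
  rw [Finset.sum_filter, Finset.mul_sum]
  refine Finset.sum_congr rfl fun σ _ => ?_
  split_ifs <;> simp

/-- The bounded size-bias inequality, in the form covering both signs of the exponent: `g` may be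
`exp (θ φ)` with `θ ≥ 0` or `-exp (θ φ)` with `θ ≤ 0`. -/
lemma sum_permEval_mul_le (n d : ℕ) (φ : MvPolynomial (Fin n × Fin n) ℝ)
    (hdeg : φ.totalDegree ≤ d) (hpos : ∀ m, 0 ≤ φ.coeff m)
    (g : Equiv.Perm (Fin n) → ℝ) (K : ℝ) (hK : 0 ≤ K)
    (hg : ∀ σ i j, g (Equiv.swap (σ i) j * σ) ≤ K * g σ)
    (hKd : ∀ k ≤ d, K ^ k * ∑ σ, g σ ≤ K ^ d * ∑ σ, g σ) :
    ∑ σ, permEval n φ σ * g σ ≤ permExp n φ * (K ^ d * ∑ σ, g σ) := by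
  have hcard : (0 : ℝ) < (Fintype.card (Equiv.Perm (Fin n)) : ℝ) := by
    exact_mod_cast Fintype.card_pos
  have hmean : ∑ σ, permEval n φ σ = ∑ m ∈ φ.support, φ.coeff m *
      ∑ σ : Equiv.Perm (Fin n) with ∀ p ∈ m.support, σ p.1 = p.2, (1 : ℝ) := by
    simpa using sum_permEval_mul n φ (fun _ => 1)
  rw [permExp, div_mul_eq_mul_div, le_div_iff₀ hcard, sum_permEval_mul, hmean, Finset.sum_mul,
    Finset.sum_mul]
  refine Finset.sum_le_sum fun m hm => ?_
  rw [mul_assoc, mul_assoc]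
  refine mul_le_mul_of_nonneg_left ?_ (hpos m)
  refine (sum_extending_le g K hK hg m.support).trans ?_
  rw [mul_right_comm, mul_comm]
  refine mul_le_mul_of_nonneg_left (hKd _ (card_support_le_of_totalDegree_le hdeg hm)) ?_
  exact Finset.sum_nonneg fun _ _ => zero_le_one

lemma sum_permEval_mul_exp_le (n d : ℕ) (φ : MvPolynomial (Fin n × Fin n) ℝ)
    (hdeg : φ.totalDegree ≤ d) (hpos : ∀ m, 0 ≤ φ.coeff m) (θ : ℝ) (hθ : 0 ≤ θ) :
    ∑ σ, permEval n φ σ * Real.exp (θ * permEval n φ σ) ≤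
      permExp n φ * (Real.exp (2 * d * AgradConst n φ * θ) *
        ∑ σ, Real.exp (θ * permEval n φ σ)) := by
  have hA := AgradConst_nonneg n φ
  have hpow : Real.exp (2 * d * AgradConst n φ * θ) = Real.exp (2 * AgradConst n φ * θ) ^ d := by
    rw [← Real.exp_nat_mul]
    ring_nf
  rw [hpow]
  refine sum_permEval_mul_le n d φ hdeg hpos _ _ (Real.exp_nonneg _) ?_ ?_
  · intro σ i j
    rw [← Real.exp_add, Real.exp_le_exp]
    nlinarith [permEval_swap_mul_le n φ hpos σ i j]
  · intro k hk
    refine mul_le_mul_of_nonneg_right ?_ (Finset.sum_nonneg fun _ _ => Real.exp_nonneg _)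
    exact pow_le_pow_right₀ (Real.one_le_exp (by positivity)) hk

lemma le_sum_permEval_mul_exp (n d : ℕ) (φ : MvPolynomial (Fin n × Fin n) ℝ)
    (hdeg : φ.totalDegree ≤ d) (hpos : ∀ m, 0 ≤ φ.coeff m) (θ : ℝ) (hθ : θ ≤ 0) :
    permExp n φ * (Real.exp (2 * d * AgradConst n φ * θ) *
        ∑ σ, Real.exp (θ * permEval n φ σ)) ≤
      ∑ σ, permEval n φ σ * Real.exp (θ * permEval n φ σ) := by
  have hA := AgradConst_nonneg n φ
  have hpow : Real.exp (2 * d * AgradConst n φ * θ) = Real.exp (2 * AgradConst n φ * θ) ^ d := by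
    rw [← Real.exp_nat_mul]
    ring_nf
  have := sum_permEval_mul_le n d φ hdeg hpos (fun σ => -Real.exp (θ * permEval n φ σ))
    (Real.exp (2 * AgradConst n φ * θ)) (Real.exp_nonneg _) ?_ ?_
  · simp only [mul_neg, Finset.sum_neg_distrib] at this
    rw [hpow]
    linarith
  · intro σ i j
    rw [mul_neg, neg_le_neg_iff, ← Real.exp_add, Real.exp_le_exp]
    nlinarith [permEval_swap_mul_le n φ hpos σ i j]
  · intro k hk
    refine mul_le_mul_of_nonpos_right ?_ ?_
    · exact pow_le_pow_of_le_one (Real.exp_nonneg _)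
        (Real.exp_le_one_iff.mpr (mul_nonpos_of_nonneg_of_nonpos (by positivity) hθ)) hk
    · exact Finset.sum_nonpos fun _ _ => neg_nonpos.mpr (Real.exp_nonneg _)

end Evaluation

section SizeBias

variable {Ω : Type*} [Fintype Ω]

/-- Integrated form of the bounded size-bias inequalities: a Poisson-type bound on the moment
generating function. -/
lemma sum_exp_le_of_sizeBias (Y : Ω → ℝ) (μ c : ℝ) (hc : 0 < c)
    (hup : ∀ θ, 0 ≤ θ → ∑ ω, Y ω * Real.exp (θ * Y ω) ≤
      μ * (Real.exp (c * θ) * ∑ ω, Real.exp (θ * Y ω)))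
    (hlow : ∀ θ, θ ≤ 0 → μ * (Real.exp (c * θ) * ∑ ω, Real.exp (θ * Y ω)) ≤
      ∑ ω, Y ω * Real.exp (θ * Y ω)) (θ : ℝ) :
    ∑ ω, Real.exp (θ * Y ω) ≤
      Fintype.card Ω * Real.exp (μ * (Real.exp (c * θ) - 1) / c) := by
  set h : ℝ → ℝ := fun θ =>
    (∑ ω, Real.exp (θ * Y ω)) * Real.exp (-(μ * (Real.exp (c * θ) - 1) / c)) with hh
  have hderiv : ∀ θ, HasDerivAt h ((∑ ω, Y ω * Real.exp (θ * Y ω) -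
      μ * (Real.exp (c * θ) * ∑ ω, Real.exp (θ * Y ω))) *
      Real.exp (-(μ * (Real.exp (c * θ) - 1) / c))) θ := by
    intro θ
    have h1 : HasDerivAt (fun θ => ∑ ω, Real.exp (θ * Y ω))
        (∑ ω, Y ω * Real.exp (θ * Y ω)) θ := by
      refine HasDerivAt.fun_sum fun ω _ => ?_
      have := ((hasDerivAt_id θ).mul_const (Y ω)).exp
      simpa [mul_comm] using this
    have h2 : HasDerivAt (fun θ => Real.exp (c * θ)) (Real.exp (c * θ) * c) θ := by
      simpa using ((hasDerivAt_id θ).const_mul c).exp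
    have h3 := (((h2.sub_const 1).const_mul μ).div_const c).neg.exp
    refine (h1.mul h3).congr_deriv ?_
    simp only [Pi.neg_apply]
    rw [← mul_assoc μ, mul_div_cancel_right₀ _ hc.ne']
    ring
  have hcont : Continuous h := continuous_iff_continuousAt.mpr fun θ => (hderiv θ).continuousAt
  have h0 : h 0 = Fintype.card Ω := by simp [hh]
  have hle : h θ ≤ h 0 := by
    rcases le_total 0 θ with hθ | hθ
    · refine antitoneOn_of_deriv_nonpos (convex_Ici 0) hcont.continuousOn
        (fun x _ => (hderiv x).differentiableAt.differentiableWithinAt) (fun x hx => ?_)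
        Set.self_mem_Ici hθ hθ
      rw [interior_Ici] at hx
      rw [(hderiv x).deriv]
      exact mul_nonpos_of_nonpos_of_nonneg (sub_nonpos.mpr (hup x (le_of_lt hx)))
        (Real.exp_nonneg _)
    · refine monotoneOn_of_deriv_nonneg (convex_Iic 0) hcont.continuousOn
        (fun x _ => (hderiv x).differentiableAt.differentiableWithinAt) (fun x hx => ?_)
        hθ Set.self_mem_Iic hθ
      rw [interior_Iic] at hx
      rw [(hderiv x).deriv]
      exact mul_nonneg (sub_nonneg.mpr (hlow x (le_of_lt hx))) (Real.exp_nonneg _)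
  rw [h0] at hle
  simp only [hh] at hle
  rwa [Real.exp_neg, ← div_eq_mul_inv, div_le_iff₀ (Real.exp_pos _)] at hle

lemma card_mul_exp_le_sum_exp (Y : Ω → ℝ) (a θ : ℝ) (S : Finset Ω)
    (hS : ∀ ω ∈ S, a ≤ θ * Y ω) : S.card * Real.exp a ≤ ∑ ω, Real.exp (θ * Y ω) := by
  rw [← nsmul_eq_mul]
  refine (Finset.card_nsmul_le_sum S (fun ω => Real.exp (θ * Y ω)) _ fun ω hω =>
    Real.exp_le_exp.mpr (hS ω hω)).trans ?_
  exact Finset.sum_le_univ_sum_of_nonneg fun _ => Real.exp_nonneg _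

/-- One-sided Bernstein-type tail bounds from the Poisson-type moment generating function bound;
`ε = 1` is the upper tail and `ε = -1` the lower tail. -/
lemma card_tail_le (Y : Ω → ℝ) (μ c t ε : ℝ) (hμ : 0 ≤ μ) (hc : 0 < c) (ht : 0 < t)
    (hε : ε ^ 2 = 1)
    (hmgf : ∀ θ, ∑ ω, Real.exp (θ * Y ω) ≤
      Fintype.card Ω * Real.exp (μ * (Real.exp (c * θ) - 1) / c))
    (S : Finset Ω) (hS : ∀ ω ∈ S, t ≤ ε * (Y ω - μ)) :
    (S.card : ℝ) ≤ Fintype.card Ω * Real.exp (-t ^ 2 / (4 * c * (μ + t))) := by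
  have hμt : 0 < μ + t := by linarith
  set x := t / (2 * (μ + t)) with hx
  have hx0 : 0 ≤ x := by positivity
  have hx1 : x ≤ 1 := by
    rw [hx, div_le_one (by positivity)]
    linarith
  have hxt : 2 * (μ + t) * x = t := by
    rw [hx]
    field_simp
  have habs : |ε * x| ≤ 1 := by
    rw [abs_le_one_iff_mul_self_le_one]
    have : ε * x * (ε * x) = x ^ 2 := by rw [← sq, mul_pow, hε, one_mul]
    nlinarith
  have hexp := (abs_le.mp (Real.abs_exp_sub_one_sub_id_le habs)).2
  have hmark := card_mul_exp_le_sum_exp Y (x * t / c + ε * x / c * μ) (ε * x / c) S (by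
    intro ω hω
    have := mul_le_mul_of_nonneg_left (hS ω hω) (div_nonneg hx0 hc.le)
    have e1 : x / c * t = x * t / c := by ring
    have e2 : x / c * (ε * (Y ω - μ)) = ε * x / c * Y ω - ε * x / c * μ := by ring
    linarith)
  have hb := hmark.trans (hmgf _)
  rw [← le_div_iff₀ (Real.exp_pos _), mul_div_assoc, ← Real.exp_sub] at hb
  refine hb.trans (mul_le_mul_of_nonneg_left (Real.exp_le_exp.mpr ?_) (Nat.cast_nonneg _))
  have e1 : c * (ε * x / c) = ε * x := by field_simp
  have e2 : -t ^ 2 / (4 * c * (μ + t)) = -(x * t / 2) / c := by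
    rw [hx]
    field_simp
    ring
  rw [e1, e2]
  have e3 : μ * (Real.exp (ε * x) - 1) / c - (x * t / c + ε * x / c * μ) =
      (μ * (Real.exp (ε * x) - 1 - ε * x) - x * t) / c := by ring
  rw [e3]
  refine div_le_div_of_nonneg_right ?_ hc.le
  have hsq : (ε * x) ^ 2 = x ^ 2 := by rw [mul_pow, hε, one_mul]
  rw [hsq] at hexp
  have := mul_le_mul_of_nonneg_left hexp hμ
  have hx2 : x * (2 * (μ + t) * x) = x * t := by rw [hxt]
  nlinarith [mul_nonneg ht.le (sq_nonneg x)]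

end SizeBias

lemma permProb_le_one (n : ℕ) (p : Equiv.Perm (Fin n) → Prop) : permProb n p ≤ 1 := by
  refine div_le_one_of_le₀ ?_ (Nat.cast_nonneg _)
  rw [← Nat.card_eq_fintype_card]
  exact_mod_cast Set.ncard_le_card _

lemma le_alphaConst (n d : ℕ) (hn : 1 ≤ n) (hd : 1 ≤ d) (φ : MvPolynomial (Fin n × Fin n) ℝ) :
    12 * d * AgradConst n φ ≤ alphaConst n d φ := by
  have hA := AgradConst_nonneg n φ
  have hn' : (0 : ℝ) < n := by exact_mod_cast hn
  have hx : (0 : ℝ) < 2 / n := by positivity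
  have h1 : Real.exp (-2 / (n : ℝ)) < 1 := by
    rw [Real.exp_lt_one_iff, neg_div]
    linarith
  have h2 : 1 - Real.exp (-2 / (n : ℝ)) ≤ 2 / n := by
    have := Real.add_one_le_exp (-2 / (n : ℝ))
    rw [neg_div] at this ⊢
    linarith
  have h3 : 1 ≤ (2 / (n : ℝ)) * (2 - Real.exp (-2 / (n : ℝ))) /
      (1 - Real.exp (-2 / (n : ℝ))) := by
    rw [le_div_iff₀ (by linarith)]
    nlinarith
  have h4 : (2 : ℝ) ≤ 2 ^ d := by
    simpa using pow_le_pow_right₀ (one_le_two : (1 : ℝ) ≤ 2) hd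
  rw [alphaConst]
  set L := max 0 (Real.log (4 * Aconst n φ * (n : ℝ) / AgradConst n φ)) with hL
  have h5 : 0 ≤ L := le_max_left _ _
  calc 12 * d * AgradConst n φ = 6 * d * 2 * AgradConst n φ * 1 := by ring
    _ ≤ _ := by gcongr; linarith

/-- Corollary 1.5: Bernstein-type concentration inequality for low-degree
functions on the symmetric group. -/
theorem concentration_low_degree_corollary (n d : ℕ) (hn : 1 ≤ n) (hd : 1 ≤ d)
    (φ : MvPolynomial (Fin n × Fin n) ℝ)
    (hml : IsMultilinear n φ) (hdeg : φ.totalDegree ≤ d)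
    (hpos : ∀ m, 0 ≤ φ.coeff m)
    (t : ℝ) (ht : 0 ≤ t) :
    permProb n (fun σ => t ≤ |permEval n φ σ - permExp n φ|) ≤
      2 * Real.exp (-t ^ 2 /
        (2 * alphaConst n d φ *
          ((4 / 3) * permExp n φ +
            (2 ^ (d + 1) * ((d : ℝ) - 1) / (3 * (n : ℝ))) * Aconst n φ + t))) := by
  have hE : 0 ≤ permExp n φ :=
    div_nonneg (Finset.sum_nonneg fun σ _ => permEval_nonneg n φ hpos σ) (Nat.cast_nonneg _)
  have hα := le_alphaConst n d hn hd φ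
  have hd' : (1 : ℝ) ≤ d := by exact_mod_cast hd
  have hn' : (0 : ℝ) < n := by exact_mod_cast hn
  have hrest : 0 ≤ (2 ^ (d + 1) * ((d : ℝ) - 1) / (3 * (n : ℝ))) * Aconst n φ :=
    mul_nonneg (div_nonneg (mul_nonneg (by positivity) (by linarith)) (by positivity))
      (Aconst_nonneg n φ)
  have htrivial : ∀ x : ℝ, x = 0 →
      permProb n (fun σ => t ≤ |permEval n φ σ - permExp n φ|) ≤ 2 * Real.exp x := by
    rintro _ rfl
    rw [Real.exp_zero]
    linarith [permProb_le_one n (fun σ => t ≤ |permEval n φ σ - permExp n φ|)]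
  rcases (AgradConst_nonneg n φ).eq_or_lt with hA | hA
  · exact htrivial _ (by simp [alphaConst, ← hA])
  rcases ht.eq_or_lt with rfl | ht'
  · exact htrivial _ (by simp)
  have hc : 0 < 2 * d * AgradConst n φ := by positivity
  have hmgf := sum_exp_le_of_sizeBias (permEval n φ) (permExp n φ) _ hc
    (sum_permEval_mul_exp_le n d φ hdeg hpos) (le_sum_permEval_mul_exp n d φ hdeg hpos)
  have hup := card_tail_le (permEval n φ) (permExp n φ) _ t 1 hE hc ht' (by norm_num) hmgf
    {σ | t ≤ 1 * (permEval n φ σ - permExp n φ)} (by simp)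
  have hlow := card_tail_le (permEval n φ) (permExp n φ) _ t (-1) hE hc ht' (by norm_num) hmgf
    {σ | t ≤ -1 * (permEval n φ σ - permExp n φ)} (by simp)
  have hcard : (0 : ℝ) < (Fintype.card (Equiv.Perm (Fin n)) : ℝ) := by
    exact_mod_cast Fintype.card_pos
  have hunion : (Set.ncard {σ | t ≤ |permEval n φ σ - permExp n φ|} : ℝ) ≤
      (Finset.card {σ | t ≤ 1 * (permEval n φ σ - permExp n φ)} : ℝ) +
      (Finset.card {σ | t ≤ -1 * (permEval n φ σ - permExp n φ)} : ℝ) := by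
    have hset : {σ | t ≤ |permEval n φ σ - permExp n φ|} =
        ((Finset.univ.filter fun σ => t ≤ 1 * (permEval n φ σ - permExp n φ)) ∪
          Finset.univ.filter fun σ => t ≤ -1 * (permEval n φ σ - permExp n φ) :
          Finset (Equiv.Perm (Fin n))) := by
      ext σ
      simp [le_abs]
    rw [hset, Set.ncard_coe_finset]
    exact_mod_cast Finset.card_union_le _ _
  have hexp : Real.exp (-t ^ 2 / (4 * (2 * d * AgradConst n φ) * (permExp n φ + t))) ≤
      Real.exp (-t ^ 2 / (2 * alphaConst n d φ * ((4 / 3) * permExp n φ +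
        (2 ^ (d + 1) * ((d : ℝ) - 1) / (3 * (n : ℝ))) * Aconst n φ + t))) := by
    rw [Real.exp_le_exp, neg_div, neg_div, neg_le_neg_iff]
    refine div_le_div_of_nonneg_left (sq_nonneg t) (by positivity) ?_
    exact mul_le_mul (by linarith) (by linarith) (by positivity) (by linarith)
  rw [permProb, div_le_iff₀ hcard]
  have := mul_le_mul_of_nonneg_left hexp hcard.le
  linarith
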